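/- arXiv:2210.13174 — 5 statements merged into one kernel-verified Lean document; each statement's English description precedes it below -/
import Mathlib

section
/- Yang–Baxter (RTT) relation for the bosonic trigonometric six-vertex model (Proposition 2.2): Let F be a field and q, x_j, x_k ∈ F with x_k − q·x_j ≠ 0. Then for all horizontal boundary labels α, β, ε, δ ∈ {0,1} and all vertical boundary multiplicities γ, φ ∈ ℕ, one has Σ_{μ,ν∈{0,1}} Σ_{m∈ℕ} ρ_{x_k,x_j}((α,β),(μ,ν)) · w_{x_k}(μ,ε,φ,m) · w_{x_j}(ν,δ,m,γ) = Σ_{μ,ν∈{0,1}} Σ_{m∈ℕ} w_{x_j}(α,μ,φ,m) · w_{x_k}(β,ν,m,γ) · ρ_{x_k,x_j}((μ,ν),(ε,δ)). (Both sums over m ∈ ℕ have only finitely many nonzero terms, because w vanishes unless the conservation law holds.) -/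
noncomputable section

/-- Bosonic six-vertex Boltzmann weight `w_z(h_l, h_r, a, b)` (left horizontal label,
right horizontal label, top vertical multiplicity, bottom vertical multiplicity). -/
def w {F : Type} [Field F] (q z : F) : Bool → Bool → ℕ → ℕ → F
  | false, false, a, b => if a = b then 1 else 0
  | true,  true,  a, b => if a = b then z else 0
  | false, true,  a, b => if a = b + 1 then 1 - q ^ a else 0
  | true,  false, a, b => if b = a + 1 then z else 0

/-- Trigonometric six-vertex R-matrix weight `ρ_{u,v}((α,β),(μ,ν))`. -/
def rho {F : Type} [Field F] (q u v : F) : Bool × Bool → Bool × Bool → F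
  | (false, false), (false, false) => 1
  | (true,  true),  (true,  true)  => 1
  | (false, true),  (true,  false) => (u - v) / (u - q * v)
  | (true,  false), (false, true)  => q * (u - v) / (u - q * v)
  | (false, true),  (false, true)  => (1 - q) * u / (u - q * v)
  | (true,  false), (true,  false) => (1 - q) * v / (u - q * v)
  | _, _ => 0

/-- Closed form of the sum over the intermediate multiplicity. -/
def wsum {F : Type} [Field F] (q z : F) (l r : Bool) (a : ℕ) (g : ℕ → F) : F :=
  match l, r with
  | false, false => g a
  | true, true => z * g a
  | false, true => (1 - q ^ a) * g (a - 1)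
  | true, false => z * g (a + 1)

lemma finsum_w {F : Type} [Field F] (q z : F) (l r : Bool) (a : ℕ) (g : ℕ → F) :
    ∑ᶠ m : ℕ, w q z l r a m * g m = wsum q z l r a g := by
  cases l <;> cases r <;> simp only [w, wsum]
  · rw [finsum_eq_single _ a (fun m hm => by simp [hm.symm])]
    simp
  · rw [finsum_eq_single _ (a - 1) (fun m hm => by
      rw [if_neg (by omega), zero_mul])]
    cases a <;> simp
  · rw [finsum_eq_single _ (a + 1) (fun m hm => by simp [hm])]
    simp
  · rw [finsum_eq_single _ a (fun m hm => by simp [hm.symm])]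
    simp

lemma finsum_left {F : Type} [Field F] (q z c : F) (l r : Bool) (a : ℕ) (g : ℕ → F) :
    ∑ᶠ m : ℕ, c * w q z l r a m * g m = wsum q z l r a (fun m => c * g m) := by
  rw [← finsum_w]
  exact finsum_congr (fun m => by ring)

lemma finsum_right {F : Type} [Field F] (q z c : F) (l r : Bool) (a : ℕ) (g : ℕ → F) :
    ∑ᶠ m : ℕ, w q z l r a m * g m * c = wsum q z l r a (fun m => g m * c) := by
  rw [← finsum_w]
  exact finsum_congr (fun m => by ring)

set_option maxHeartbeats 8000000 in
/-- Yang–Baxter (RTT) relation for the bosonic trigonometric six-vertex model. -/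
theorem stmt0 {F : Type} [Field F] (q xj xk : F) (hden : xk - q * xj ≠ 0)
    (α β ε δ : Bool) (γ φ : ℕ) :
    ∑ μ : Bool, ∑ ν : Bool, ∑ᶠ m : ℕ,
        rho q xk xj (α, β) (μ, ν) * w q xk μ ε φ m * w q xj ν δ m γ
      = ∑ μ : Bool, ∑ ν : Bool, ∑ᶠ m : ℕ,
        w q xj α μ φ m * w q xk β ν m γ * rho q xk xj (μ, ν) (ε, δ) := by
  have hden2 : xk - xj * q ≠ 0 := by rwa [mul_comm xj q]
  simp only [finsum_left, finsum_right, Fintype.sum_bool]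
  rcases φ with _ | _ | n <;> cases α <;> cases β <;> cases ε <;> cases δ <;>
    simp only [wsum, w, rho, Nat.add_sub_cancel, Nat.zero_sub, zero_add, zero_mul, mul_zero, add_zero, pow_zero, sub_self, mul_one, one_mul] <;>
    (try split_ifs) <;> first
      | omega
      | (simp; done)
      | (field_simp; done)
      | (subst_vars; field_simp; done)
      | (exfalso; omega)
      | (field_simp; ring1)
      | (subst_vars; field_simp; ring1)
end
end

section
/- Two-particle Caduceus identity in regime 1(b), boundary (1,0,1,0) (from the proof of Lemma 3.2): In ℚ(q, x₁, x₂), writing x̄ᵢ = xᵢ⁻¹, one has b₁(x₁,x̄₂)·b₂(x̄₁,x₂) + c₂(x₁,x₂)·c₁(x₁,x̄₂)·c₁(x̄₁,x₂)·c₂(x̄₁,x̄₂) − q·c₂(x₁,x₂)·c₁(x̄₁,x₂)·b₁(x̄₁,x̄₂) − q·b₁(x₁,x₂)·c₁(x̄₁,x₂)·c₂(x̄₁,x̄₂) + q²·b₁(x₁,x₂)·c₂(x₁,x̄₂)·c₁(x̄₁,x₂)·b₁(x̄₁,x̄₂) = 1. -/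
noncomputable section

/-- `ℚ(q, x₁, x₂)`, the field of rational functions in `q, x₁, x₂` over `ℚ`. -/
abbrev KQ : Type := FractionRing (MvPolynomial (Fin 3) ℚ)

/-- The element `q` of `ℚ(q, x₁, x₂)`. -/
def qq : KQ := algebraMap (MvPolynomial (Fin 3) ℚ) KQ (MvPolynomial.X 0)

/-- The element `x₁`. -/
def X1 : KQ := algebraMap (MvPolynomial (Fin 3) ℚ) KQ (MvPolynomial.X 1)

/-- The element `x₂`. -/
def X2 : KQ := algebraMap (MvPolynomial (Fin 3) ℚ) KQ (MvPolynomial.X 2)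

/-- R-matrix weight `b₁(u,v) = (u−v)/(u−qv)`. -/
def b1 (u v : KQ) : KQ := (u - v) / (u - qq * v)

/-- R-matrix weight `b₂(u,v) = q(u−v)/(u−qv)`. -/
def b2 (u v : KQ) : KQ := qq * (u - v) / (u - qq * v)

/-- R-matrix weight `c₁(u,v) = (1−q)u/(u−qv)`. -/
def c1 (u v : KQ) : KQ := (1 - qq) * u / (u - qq * v)

/-- R-matrix weight `c₂(u,v) = (1−q)v/(u−qv)`. -/
def c2 (u v : KQ) : KQ := (1 - qq) * v / (u - qq * v)

/-- A polynomial that does not vanish at some rational point is nonzero in the fraction field. -/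
lemma algebraMap_ne_zero_of_eval (p : MvPolynomial (Fin 3) ℚ) (f : Fin 3 → ℚ)
    (h : MvPolynomial.eval f p ≠ 0) : algebraMap (MvPolynomial (Fin 3) ℚ) KQ p ≠ 0 := by
  intro h0
  have hp : p = 0 := (IsFractionRing.injective (MvPolynomial (Fin 3) ℚ) KQ) (by rw [h0, map_zero])
  exact h (by rw [hp, map_zero])

/-- The identity in an arbitrary field, under the nonvanishing of the denominators. -/
lemma caduceus_field {F : Type*} [Field F] (q x y : F) (hx : x ≠ 0) (hy : y ≠ 0)
    (h1 : x - q * y ≠ 0) (h2 : x * y - q ≠ 0) (h3 : 1 - q * (x * y) ≠ 0) (h4 : y - q * x ≠ 0) :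
    (x - y⁻¹) / (x - q * y⁻¹) * (q * (x⁻¹ - y) / (x⁻¹ - q * y))
      + (1 - q) * y / (x - q * y) * ((1 - q) * x / (x - q * y⁻¹))
        * ((1 - q) * x⁻¹ / (x⁻¹ - q * y)) * ((1 - q) * y⁻¹ / (x⁻¹ - q * y⁻¹))
      - q * ((1 - q) * y / (x - q * y) * ((1 - q) * x⁻¹ / (x⁻¹ - q * y))
        * ((x⁻¹ - y⁻¹) / (x⁻¹ - q * y⁻¹)))
      - q * ((x - y) / (x - q * y) * ((1 - q) * x⁻¹ / (x⁻¹ - q * y))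
        * ((1 - q) * y⁻¹ / (x⁻¹ - q * y⁻¹)))
      + q ^ 2 * ((x - y) / (x - q * y) * ((1 - q) * y⁻¹ / (x - q * y⁻¹))
        * ((1 - q) * x⁻¹ / (x⁻¹ - q * y)) * ((x⁻¹ - y⁻¹) / (x⁻¹ - q * y⁻¹))) = 1 := by
  have e2 : x - q * y⁻¹ = (x * y - q) / y := by field_simp
  have e3 : x⁻¹ - q * y = (1 - q * (x * y)) / x := by field_simp
  have e4 : x⁻¹ - q * y⁻¹ = (y - q * x) / (x * y) := by field_simp
  have e5 : x - y⁻¹ = (x * y - 1) / y := by field_simp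
  have e6 : x⁻¹ - y = (1 - x * y) / x := by field_simp
  have e7 : x⁻¹ - y⁻¹ = (y - x) / (x * y) := by field_simp
  rw [e2, e3, e4, e5, e6, e7]
  generalize ha : x - q * y = a at *
  generalize hb : x * y - q = b at *
  generalize hc : 1 - q * (x * y) = c at *
  generalize hd : y - q * x = d at *
  field_simp
  subst ha hb hc hd
  ring

/-- Two-particle Caduceus identity in regime 1(b), boundary (1,0,1,0). -/
theorem stmt3 :
    b1 X1 X2⁻¹ * b2 X1⁻¹ X2
      + c2 X1 X2 * c1 X1 X2⁻¹ * c1 X1⁻¹ X2 * c2 X1⁻¹ X2⁻¹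
      - qq * (c2 X1 X2 * c1 X1⁻¹ X2 * b1 X1⁻¹ X2⁻¹)
      - qq * (b1 X1 X2 * c1 X1⁻¹ X2 * c2 X1⁻¹ X2⁻¹)
      + qq ^ 2 * (b1 X1 X2 * c2 X1 X2⁻¹ * c1 X1⁻¹ X2 * b1 X1⁻¹ X2⁻¹) = 1 := by
  have key : ∀ p : MvPolynomial (Fin 3) ℚ, MvPolynomial.eval ![3, 2, 5] p ≠ 0 →
      algebraMap (MvPolynomial (Fin 3) ℚ) KQ p ≠ 0 :=
    fun p hp => algebraMap_ne_zero_of_eval p _ hp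
  have hx : X1 ≠ 0 := key (MvPolynomial.X 1) (by simp)
  have hy : X2 ≠ 0 := key (MvPolynomial.X 2) (by simp)
  have h1 : X1 - qq * X2 ≠ 0 := by
    have := key (MvPolynomial.X 1 - MvPolynomial.X 0 * MvPolynomial.X 2) (by simp; norm_num)
    simpa only [X1, X2, qq, map_sub, map_mul] using this
  have h2 : X1 * X2 - qq ≠ 0 := by
    have := key (MvPolynomial.X 1 * MvPolynomial.X 2 - MvPolynomial.X 0) (by simp; norm_num)
    simpa only [X1, X2, qq, map_sub, map_mul] using this
  have h3 : 1 - qq * (X1 * X2) ≠ 0 := by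
    have := key (1 - MvPolynomial.X 0 * (MvPolynomial.X 1 * MvPolynomial.X 2))
      (by simp; norm_num)
    simpa only [X1, X2, qq, map_sub, map_mul, map_one] using this
  have h4 : X2 - qq * X1 ≠ 0 := by
    have := key (MvPolynomial.X 2 - MvPolynomial.X 0 * MvPolynomial.X 1) (by simp; norm_num)
    simpa only [X1, X2, qq, map_sub, map_mul] using this
  exact caduceus_field qq X1 X2 hx hy h1 h2 h3 h4
end
end

section
/- Two-particle Caduceus difference identity in regime 1(a) (from the proof of Lemma 3.2): Let A₁, A₂, D₁, D₂, C₁, C₂ be arbitrary elements of K = ℚ(q, x₁, x₂) that do not involve x₁, x₂ (for instance, elements of ℚ(q)), and write x̄ᵢ = xᵢ⁻¹. Define S₁₀₁₀ = A₁D₂·[c₂(x₁,x̄₂)b₂(x̄₁,x₂) + c₂(x₁,x₂)b₂(x₁,x̄₂)c₁(x̄₁,x₂)c₂(x̄₁,x̄₂)] + C₁C₂·[b₁(x₁,x̄₂)b₂(x̄₁,x₂) + c₂(x₁,x₂)c₁(x₁,x̄₂)c₁(x̄₁,x₂)c₂(x̄₁,x̄₂) + c₂(x₁,x₂)c₁(x̄₁,x₂)b₁(x̄₁,x̄₂)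 + b₁(x₁,x₂)c₁(x̄₁,x₂)c₂(x̄₁,x̄₂) + b₁(x₁,x₂)c₂(x₁,x̄₂)c₁(x̄₁,x₂)b₁(x̄₁,x̄₂)] + A₂D₁·b₁(x₁,x₂)b₁(x₁,x̄₂)c₁(x̄₁,x₂)b₁(x̄₁,x̄₂), and S₁₀₀₁ = A₁D₂·c₂(x₁,x₂)b₂(x₁,x̄₂)b₂(x̄₁,x̄₂) + C₁C₂·[c₂(x₁,x₂)c₁(x₁,x̄₂)b₂(x̄₁,x̄₂) + c₂(x₁,x₂)c₁(x̄₁,x̄₂) + b₁(x₁,x₂)b₂(x̄₁,x̄₂) + b₁(x₁,x₂)c₂(x₁,x̄₂)c₁(x̄₁,x̄₂)] + A₂D₁·b₁(x₁,x₂)b₁(x₁,x̄₂)c₁(x̄₁,x̄₂). Then S₁₀₁₀ − S₁₀₀₁ = (q²(A₁D₂ − C₁C₂) − (A₂D₁ − C₁C₂)) · (1−q)(qx₂² − 1)(x₁ − x̄₂)(x̄₁ − x̄₂) / ((x₁ − qx₂)(x₁ − qx̄₂)(x̄₁ − qx₂)(x̄₁ − qx̄₂)). In particular, the two-particle caduceus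 relation in regime 1(a) holds if and only if q²(A₁D₂ − C₁C₂) = A₂D₁ − C₁C₂. -/
noncomputable section

/-- The two-particle caduceus partition function with boundary `(1,0,1,0)` in regime 1(a). -/
def S1010 (A1 A2 D1 D2 C1 C2 : KQ) : KQ :=
  A1 * D2 * (c2 X1 X2⁻¹ * b2 X1⁻¹ X2
      + c2 X1 X2 * b2 X1 X2⁻¹ * c1 X1⁻¹ X2 * c2 X1⁻¹ X2⁻¹)
  + C1 * C2 * (b1 X1 X2⁻¹ * b2 X1⁻¹ X2
      + c2 X1 X2 * c1 X1 X2⁻¹ * c1 X1⁻¹ X2 * c2 X1⁻¹ X2⁻¹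
      + c2 X1 X2 * c1 X1⁻¹ X2 * b1 X1⁻¹ X2⁻¹
      + b1 X1 X2 * c1 X1⁻¹ X2 * c2 X1⁻¹ X2⁻¹
      + b1 X1 X2 * c2 X1 X2⁻¹ * c1 X1⁻¹ X2 * b1 X1⁻¹ X2⁻¹)
  + A2 * D1 * (b1 X1 X2 * b1 X1 X2⁻¹ * c1 X1⁻¹ X2 * b1 X1⁻¹ X2⁻¹)

/-- The two-particle caduceus partition function with boundary `(1,0,0,1)` in regime 1(a). -/
def S1001 (A1 A2 D1 D2 C1 C2 : KQ) : KQ :=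
  A1 * D2 * (c2 X1 X2 * b2 X1 X2⁻¹ * b2 X1⁻¹ X2⁻¹)
  + C1 * C2 * (c2 X1 X2 * c1 X1 X2⁻¹ * b2 X1⁻¹ X2⁻¹
      + c2 X1 X2 * c1 X1⁻¹ X2⁻¹
      + b1 X1 X2 * b2 X1⁻¹ X2⁻¹
      + b1 X1 X2 * c2 X1 X2⁻¹ * c1 X1⁻¹ X2⁻¹)
  + A2 * D1 * (b1 X1 X2 * b1 X1 X2⁻¹ * c1 X1⁻¹ X2⁻¹)

/-- A polynomial with a nonzero value at `(2,3,5)` is nonzero in the fraction field. -/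
theorem aux_ne (p : MvPolynomial (Fin 3) ℚ)
    (h : MvPolynomial.eval (![2, 3, 5] : Fin 3 → ℚ) p ≠ 0) :
    algebraMap (MvPolynomial (Fin 3) ℚ) KQ p ≠ 0 := by
  intro h0
  have hp : p = 0 := by
    apply IsFractionRing.injective (MvPolynomial (Fin 3) ℚ) KQ
    rw [h0, map_zero]
  exact h (by rw [hp, map_zero])

theorem aux_id {F : Type*} [Field F] (q x y A B C : F) (hx : x ≠ 0) (hy : y ≠ 0)
    (h1 : x - q * y ≠ 0) (h2 : x * y - q ≠ 0) (h3 : 1 - q * (x * y) ≠ 0) (h4 : y - q * x ≠ 0) :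
    A * ((1 - q) * y⁻¹ / (x - q * y⁻¹) * (q * (x⁻¹ - y) / (x⁻¹ - q * y))
      + (1 - q) * y / (x - q * y) * (q * (x - y⁻¹) / (x - q * y⁻¹))
        * ((1 - q) * x⁻¹ / (x⁻¹ - q * y)) * ((1 - q) * y⁻¹ / (x⁻¹ - q * y⁻¹)))
    + C * ((x - y⁻¹) / (x - q * y⁻¹) * (q * (x⁻¹ - y) / (x⁻¹ - q * y))
      + (1 - q) * y / (x - q * y) * ((1 - q) * x / (x - q * y⁻¹))
        * ((1 - q) * x⁻¹ / (x⁻¹ - q * y)) * ((1 - q) * y⁻¹ / (x⁻¹ - q * y⁻¹))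
      + (1 - q) * y / (x - q * y) * ((1 - q) * x⁻¹ / (x⁻¹ - q * y))
        * ((x⁻¹ - y⁻¹) / (x⁻¹ - q * y⁻¹))
      + (x - y) / (x - q * y) * ((1 - q) * x⁻¹ / (x⁻¹ - q * y))
        * ((1 - q) * y⁻¹ / (x⁻¹ - q * y⁻¹))
      + (x - y) / (x - q * y) * ((1 - q) * y⁻¹ / (x - q * y⁻¹))
        * ((1 - q) * x⁻¹ / (x⁻¹ - q * y)) * ((x⁻¹ - y⁻¹) / (x⁻¹ - q * y⁻¹)))
    + B * ((x - y) / (x - q * y) * ((x - y⁻¹) / (x - q * y⁻¹))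
        * ((1 - q) * x⁻¹ / (x⁻¹ - q * y)) * ((x⁻¹ - y⁻¹) / (x⁻¹ - q * y⁻¹)))
    - (A * ((1 - q) * y / (x - q * y) * (q * (x - y⁻¹) / (x - q * y⁻¹))
        * (q * (x⁻¹ - y⁻¹) / (x⁻¹ - q * y⁻¹)))
    + C * ((1 - q) * y / (x - q * y) * ((1 - q) * x / (x - q * y⁻¹))
        * (q * (x⁻¹ - y⁻¹) / (x⁻¹ - q * y⁻¹))
      + (1 - q) * y / (x - q * y) * ((1 - q) * x⁻¹ / (x⁻¹ - q * y⁻¹))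
      + (x - y) / (x - q * y) * (q * (x⁻¹ - y⁻¹) / (x⁻¹ - q * y⁻¹))
      + (x - y) / (x - q * y) * ((1 - q) * y⁻¹ / (x - q * y⁻¹))
        * ((1 - q) * x⁻¹ / (x⁻¹ - q * y⁻¹)))
    + B * ((x - y) / (x - q * y) * ((x - y⁻¹) / (x - q * y⁻¹))
        * ((1 - q) * x⁻¹ / (x⁻¹ - q * y⁻¹))))
    = (q ^ 2 * (A - C) - (B - C)) *
          ((1 - q) * (q * y ^ 2 - 1) * (x - y⁻¹) * (x⁻¹ - y⁻¹)) /
          ((x - q * y) * (x - q * y⁻¹) * (x⁻¹ - q * y) * (x⁻¹ - q * y⁻¹)) := by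
  have e2 : x - q * y⁻¹ = (x * y - q) / y := by field_simp
  have e3 : x⁻¹ - q * y = (1 - q * (x * y)) / x := by field_simp
  have e4 : x⁻¹ - q * y⁻¹ = (y - q * x) / (x * y) := by field_simp
  rw [e2, e3, e4]
  generalize hd1 : x - q * y = d1 at *
  generalize hd2 : x * y - q = d2 at *
  generalize hd3 : 1 - q * (x * y) = d3 at *
  generalize hd4 : y - q * x = d4 at *
  clear e2 e3 e4
  field_simp
  subst hd1 hd2 hd3 hd4
  ring

/-- Two-particle Caduceus difference identity in regime 1(a): the bend weights
`A₁, A₂, D₁, D₂, C₁, C₂` do not involve `x₁, x₂`, i.e. lie in `ℚ(q)`, the subfield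
of `ℚ(q,x₁,x₂)` generated by `q`. -/
theorem stmt6 (A1 A2 D1 D2 C1 C2 : KQ)
    (hA1 : A1 ∈ Subfield.closure {qq}) (hA2 : A2 ∈ Subfield.closure {qq})
    (hD1 : D1 ∈ Subfield.closure {qq}) (hD2 : D2 ∈ Subfield.closure {qq})
    (hC1 : C1 ∈ Subfield.closure {qq}) (hC2 : C2 ∈ Subfield.closure {qq}) :
    S1010 A1 A2 D1 D2 C1 C2 - S1001 A1 A2 D1 D2 C1 C2
      = (qq ^ 2 * (A1 * D2 - C1 * C2) - (A2 * D1 - C1 * C2)) *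
          ((1 - qq) * (qq * X2 ^ 2 - 1) * (X1 - X2⁻¹) * (X1⁻¹ - X2⁻¹)) /
          ((X1 - qq * X2) * (X1 - qq * X2⁻¹) * (X1⁻¹ - qq * X2) * (X1⁻¹ - qq * X2⁻¹)) := by
  have hx : X1 ≠ 0 := aux_ne _ (by simp)
  have hy : X2 ≠ 0 := aux_ne _ (by simp)
  have h1 : X1 - qq * X2 ≠ 0 := by
    have := aux_ne (MvPolynomial.X 1 - MvPolynomial.X 0 * MvPolynomial.X 2) (by simp; norm_num)
    rwa [map_sub, map_mul] at this
  have h2 : X1 * X2 - qq ≠ 0 := by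
    have := aux_ne (MvPolynomial.X 1 * MvPolynomial.X 2 - MvPolynomial.X 0) (by simp; norm_num)
    rwa [map_sub, map_mul] at this
  have h3 : 1 - qq * (X1 * X2) ≠ 0 := by
    have := aux_ne (1 - MvPolynomial.X 0 * (MvPolynomial.X 1 * MvPolynomial.X 2))
      (by simp; norm_num)
    rwa [map_sub, map_mul, map_mul, map_one] at this
  have h4 : X2 - qq * X1 ≠ 0 := by
    have := aux_ne (MvPolynomial.X 2 - MvPolynomial.X 0 * MvPolynomial.X 1) (by simp; norm_num)
    rwa [map_sub, map_mul] at this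
  exact aux_id qq X1 X2 (A1 * D2) (A2 * D1) (C1 * C2) hx hy h1 h2 h3 h4
end
end

section
/- Inversion symmetry of the partition function (Lemma 3.6): Consider the type B/C lattice model of rank r with partition λ and bend weights A_j, B_j, C_j, D_j ∈ F = ℂ(q, x₁, …, x_r), and fix i ∈ {1, …, r}. Assume the bend weights A_j, B_j, C_j, D_j for every j ≠ i do not involve xᵢ. Let σᵢ be the field automorphism of F fixing q and x_j for j ≠ i and sending xᵢ ↦ xᵢ⁻¹. (1) If either [Bᵢ = Cᵢ with Aᵢ, Bᵢ, Cᵢ, Dᵢ ∈ ℂ[q], i.e. bend i is in regime 1(a)] or [Cᵢ = mᵢxᵢ⁻¹ and Bᵢ = q·mᵢxᵢ with mᵢ, Aᵢ, Dᵢ ∈ ℂ[q], i.e. bend i is in regime 2(b)], then σᵢ(Z_λ) = Z_λ. (2) If either [Bᵢ = −qCᵢ with Cᵢ ∈ ℂ[q] and Aᵢ = Dᵢ = 0, i.e. regime 1(b)] or [Cᵢ = mᵢxᵢ⁻¹ and Bᵢ = −mᵢxᵢ with mᵢ ∈ ℂ[q] and Aᵢ = Dᵢ = 0, i.e. regime 2(a)],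 then σᵢ((xᵢ⁻¹ − qxᵢ)·Z_λ) = (xᵢ⁻¹ − qxᵢ)·Z_λ. -/
noncomputable section

/-- Bosonic six-vertex Boltzmann weight `w_z(h_l, h_r, a, b)` (left horizontal label,
right horizontal label, top vertical multiplicity, bottom vertical multiplicity). -/
def sixw {F : Type} [Field F] (q z : F) : Bool → Bool → ℕ → ℕ → F
  | false, false, a, b => if a = b then 1 else 0
  | true,  true,  a, b => if a = b then z else 0
  | false, true,  a, b => if a = b + 1 then 1 - q ^ a else 0
  | true,  false, a, b => if b = a + 1 then z else 0

/-- Bend weight selector; the arguments are the left-boundary labels of the two rows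
meeting the bend (top row of the pair first, bottom row second). -/
def bendw {F : Type} [Field F] (A B C D : F) : Bool → Bool → F
  | false, false => A
  | true,  false => C
  | false, true  => B
  | true,  true  => D

/-- A state of the type B/C lattice model of rank `r` with bottom boundary given by the
partition `lam` and `L+1` columns: `m s c` is the multiplicity on the vertical edge
below row `s` (0-indexed from the bottom) in column `c`, and `h s c` is the occupancy of
the horizontal edge to the left of column `c` in row `s`. -/
structure BCState (r : ℕ) (lam : Fin r → ℕ) (L : ℕ) where
  m : Fin (2*r+1) → Fin (L+1) → ℕ
  h : Fin (2*r) → Fin (L+2) → Bool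
  bottom : ∀ c : Fin (L+1), m 0 c = (Finset.univ.filter (fun i => lam i = c.val)).card
  top : ∀ c : Fin (L+1), m (Fin.last (2*r)) c = 0
  right : ∀ s : Fin (2*r), h s (Fin.last (L+1)) = false

/-- The spectral parameter of row `s` (0-indexed from the bottom): row `2i-1` (1-indexed)
carries `xᵢ⁻¹` and row `2i` carries `xᵢ`. -/
def rowp {F : Type} [Field F] {r : ℕ} (x : Fin r → F) (s : Fin (2*r)) : F :=
  if s.val % 2 = 0 then (x ⟨s.val / 2, by have := s.isLt; omega⟩)⁻¹
  else x ⟨s.val / 2, by have := s.isLt; omega⟩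

/-- The Boltzmann weight of a state: the product of the six-vertex weights at all
tetravalent vertices times the product of the bend weights. -/
def stateWeight {F : Type} [Field F] {r : ℕ} {lam : Fin r → ℕ} {L : ℕ}
    (q : F) (x : Fin r → F) (A B C D : Fin r → F) (st : BCState r lam L) : F :=
  (∏ s : Fin (2*r), ∏ c : Fin (L+1),
      sixw q (rowp x s) (st.h s c.castSucc) (st.h s c.succ)
        (st.m s.succ c) (st.m s.castSucc c)) *
  ∏ i : Fin r,
      bendw (A i) (B i) (C i) (D i)
        (st.h ⟨2*i.val+1, by have := i.isLt; omega⟩ 0)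
        (st.h ⟨2*i.val, by have := i.isLt; omega⟩ 0)

/-- The partition function of the type B/C lattice model: the sum of the weights of all
states (only finitely many have nonzero weight). -/
def ZBC {F : Type} [Field F] {r : ℕ} (lam : Fin r → ℕ) (L : ℕ)
    (q : F) (x : Fin r → F) (A B C D : Fin r → F) : F :=
  ∑ᶠ st : BCState r lam L, stateWeight q x A B C D st

/-- `ℂ(q, x₁, …, x_r)` as the fraction field of `ℂ[q, x₁, …, x_r]`. -/
abbrev FF (r : ℕ) : Type := FractionRing (MvPolynomial (Fin (r+1)) ℂ)

/-- The element `q`. -/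
def qv (r : ℕ) : FF r :=
  algebraMap (MvPolynomial (Fin (r+1)) ℂ) (FF r) (MvPolynomial.X 0)

/-- The element `xᵢ`. -/
def xv (r : ℕ) (i : Fin r) : FF r :=
  algebraMap (MvPolynomial (Fin (r+1)) ℂ) (FF r) (MvPolynomial.X i.succ)

/-- The embedding of the constants `ℂ` into `ℂ(q, x₁, …, x_r)`. -/
def cC (r : ℕ) : ℂ →+* FF r :=
  (algebraMap (MvPolynomial (Fin (r+1)) ℂ) (FF r)).comp MvPolynomial.C

/-- `a` lies in `ℂ[q] ⊆ ℂ(q, x₁, …, x_r)`. -/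
def IsPolyQ (r : ℕ) (a : FF r) : Prop :=
  ∃ p : Polynomial ℂ, a = Polynomial.eval₂ (cC r) (qv r) p

/-- The subfield `ℂ(q, x_k : k ≠ i)` of elements not involving `xᵢ`. -/
def NoXi (r : ℕ) (i : Fin r) : Subfield (FF r) :=
  Subfield.closure (Set.range (cC r) ∪ {qv r} ∪ (xv r '' {k | k ≠ i}))


theorem sum_sixw {F : Type} [Field F] (q y : F) (f : ℕ → F) (c : ℕ) (b b' : Bool) :
    ∑ m ∈ Finset.range (c+2), f m * sixw q y b b' m c =
      match b, b' with
      | false, false => f c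
      | true, true => f c * y
      | false, true => f (c+1) * (1 - q^(c+1))
      | true, false => if c = 0 then 0 else f (c-1) * y := by
  cases b <;> cases b' <;> simp only [sixw, mul_ite, mul_one, mul_zero]
  · rw [Finset.sum_ite_eq' ]; simp
  · rw [Finset.sum_ite_eq' ]; simp
  · rcases c with _ | c
    · simp
    · simp only [Nat.add_right_cancel_iff]
      rw [Finset.sum_ite_eq, if_pos (Finset.mem_range.2 (by omega))]; simp
  · rw [Finset.sum_ite_eq' ]; simp

/-- Two-row column weight. -/
def colM {F : Type} [Field F] (q x y : F) (t t' : Bool × Bool) (a c : ℕ) : F :=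
  ∑ m ∈ Finset.range (c+2), sixw q x t.1 t'.1 a m * sixw q y t.2 t'.2 m c

/-- The good family of bend functionals. -/
def bet {F : Type} [Field F] (q x y A D p k : F) (t : Bool × Bool) : F :=
  bendw A (p + k * (q * x)) (p + k * y) D t.1 t.2

theorem step {F : Type} [Field F] (q A D p k : F) (a c : ℕ) :
    ∀ x y : F, ∃ A' D' p' k' : F,
      (∀ t', ∑ t : Bool × Bool, bet q x y A D p k t * colM q x y t t' a c =
        bet q x y A' D' p' k' t') ∧
      (∀ t', ∑ t : Bool × Bool, bet q y x A D p k t * colM q y x t t' a c =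
        bet q y x A' D' p' k' t') := by
  intro x y
  have key : ∀ x y : F, ∀ t', ∑ t : Bool × Bool, bet q x y A D p k t * colM q x y t t' a c =
      bet q x y 
       ((if a = c then A else 0) + (if c = a + 2 then D * (x * y) else 0)
        + (if c = a + 1 then p * (x+y) + k * (x*y*(1+q)) else 0))
       ((if a = c + 2 then A * (1 - q^a) * (1-q^(c+1)) else 0)
        + (if a = c then D * (x * y) else 0)
        + (if a = c + 1 then (1 - q^a) * (p * (x+y) + k * (x*y*(1+q))) else 0))
       ((if a = c + 1 then A * (1 - q^a) else 0)
        + (if c = a + 1 then D * (x * y) else 0)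
        + (if a = c then p * (x+y) + k*(x*y)*(1+q-q^(c+1)) else 0))
       (if a = c then - q^c * p else 0) t' := by
    intro x y t'
    obtain ⟨t1, t2⟩ := t'
    simp only [colM, sum_sixw, Fintype.sum_prod_type, Fintype.sum_bool]
    rcases c with _ | c <;>
    cases t1 <;> cases t2 <;> simp only [bet, bendw, sixw, Nat.add_sub_cancel, if_true] <;>
    split_ifs <;> first | contradiction | omega | (subst_vars; ring1)
  refine ⟨_, _, _, _, key x y, ?_⟩
  have := key y x
  rwa [add_comm y x, mul_comm y x] at this

/-- Path sum over `n` columns. -/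
def pathS {F : Type} [Field F] (q x y : F) (n : ℕ) (b : Bool × Bool → F) (a c : Fin n → ℕ) : F :=
  ∑ g : Fin (n+1) → Bool × Bool, if g (Fin.last n) = (false, false) then
    b (g 0) * ∏ j : Fin n, colM q x y (g j.castSucc) (g j.succ) (a j) (c j) else 0

theorem pathS_succ {F : Type} [Field F] (q x y : F) (n : ℕ) (b : Bool × Bool → F)
    (a c : Fin (n+1) → ℕ) :
    pathS q x y (n+1) b a c =
      pathS q x y n (fun t' => ∑ t, b t * colM q x y t t' (a 0) (c 0))
        (fun j => a j.succ) (fun j => c j.succ) := by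
  unfold pathS
  rw [← (Fin.consEquiv (fun _ : Fin (n+2) => Bool × Bool)).sum_comp, Fintype.sum_prod_type,
    Finset.sum_comm]
  refine Finset.sum_congr rfl fun g _ => ?_
  simp only [Fin.consEquiv, Equiv.coe_fn_mk, ← Fin.succ_last, Fin.cons_succ, Fin.cons_zero]
  split_ifs with h
  · rw [Finset.sum_mul]
    refine Finset.sum_congr rfl fun t _ => ?_
    rw [Fin.prod_univ_succ]
    simp only [Fin.castSucc_zero, Fin.cons_zero, Fin.cons_succ, Fin.castSucc_succ]
    ring
  · simp

theorem pathS_symm {F : Type} [Field F] (q x y : F) (n : ℕ) : ∀ (A D p k : F)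
    (a c : Fin n → ℕ),
    pathS q x y n (bet q x y A D p k) a c = pathS q y x n (bet q y x A D p k) a c := by
  induction n with
  | zero =>
    intro A D p k a c
    unfold pathS
    refine Finset.sum_congr rfl fun g _ => ?_
    simp only [Fin.last_zero, Finset.univ_eq_empty, Finset.prod_empty, mul_one]
    split_ifs with h
    · simp [h, bet, bendw]
    · rfl
  | succ n ih =>
    intro A D p k a c
    rw [pathS_succ, pathS_succ]
    obtain ⟨A', D', p', k', h1, h2⟩ := step q A D p k (a 0) (c 0) x y
    rw [funext h1, funext h2]
    exact ih _ _ _ _ _ _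

theorem sixw_ne {F : Type} [Field F] {q z : F} {l r : Bool} {a b : ℕ}
    (h : sixw q z l r a b ≠ 0) : a ≤ b + 1 := by
  cases l <;> cases r <;> simp only [sixw] at h <;> split_ifs at h <;>
    first | omega | exact absurd rfl h

theorem pair_sum {F : Type} [Field F] (q x y : F) (n : ℕ) (b : Bool × Bool → F)
    (a c : Fin n → ℕ) :
    ∑ᶠ p : (Fin n → ℕ) × {g : Fin (n+1) → Bool × Bool // g (Fin.last n) = (false, false)},
      b (p.2.1 0) * ∏ j : Fin n,
        (sixw q x (p.2.1 j.castSucc).1 (p.2.1 j.succ).1 (a j) (p.1 j) *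
          sixw q y (p.2.1 j.castSucc).2 (p.2.1 j.succ).2 (p.1 j) (c j)) =
    pathS q x y n b a c := by
  classical
  rw [finsum_eq_sum_of_support_subset (s :=
    (Fintype.piFinset fun j => Finset.range (c j + 2)) ×ˢ Finset.univ)]
  · rw [Finset.sum_product_right]
    unfold pathS
    rw [← Finset.sum_filter]
    rw [Finset.sum_subtype (p := fun g : Fin (n+1) → Bool × Bool =>
      g (Fin.last n) = (false, false)) _ (by simp)]
    refine Finset.sum_congr rfl fun g _ => ?_
    dsimp only
    rw [← Finset.mul_sum]
    unfold colM
    rw [Finset.prod_univ_sum]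
  · intro p hp
    rw [Function.mem_support] at hp
    have h2 := right_ne_zero_of_mul hp
    rw [Finset.prod_ne_zero_iff] at h2
    simp only [Finset.coe_product, Set.mem_prod, Finset.mem_coe, Fintype.mem_piFinset,
      Finset.mem_range, Finset.mem_univ, and_true]
    intro j
    have := sixw_ne (right_ne_zero_of_mul (h2 j (Finset.mem_univ _)))
    omega

theorem BCState.ext' {r : ℕ} {lam : Fin r → ℕ} {L : ℕ} {s t : BCState r lam L}
    (hm : s.m = t.m) (hh : s.h = t.h) : s = t := by
  cases s; cases t; simp_all

theorem bounded_finite (r : ℕ) (lam : Fin r → ℕ) (L N : ℕ) :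
    {st : BCState r lam L | ∀ s c, st.m s c ≤ N}.Finite := by
  rw [← Set.finite_coe_iff]
  let f : {st : BCState r lam L | ∀ s c, st.m s c ≤ N} →
      (Fin (2*r+1) → Fin (L+1) → Fin (N+1)) × (Fin (2*r) → Fin (L+2) → Bool) :=
    fun st => (fun s c => ⟨st.1.m s c, Nat.lt_succ_of_le (st.2 s c)⟩, st.1.h)
  refine Finite.of_injective f ?_
  rintro ⟨s, hs⟩ ⟨t, ht⟩ h
  simp only [f, Prod.mk.injEq] at h
  apply Subtype.ext
  apply BCState.ext' _ h.2
  funext i j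
  have := congrFun (congrFun h.1 i) j
  simpa using this

theorem weight_finite {F : Type} [Field F] {r : ℕ} (lam : Fin r → ℕ) (L : ℕ)
    (q : F) (x : Fin r → F) (A B C D : Fin r → F) :
    (Function.support (fun st : BCState r lam L => stateWeight q x A B C D st)).Finite := by
  refine (bounded_finite r lam L (r + 2*r)).subset ?_
  intro st hst
  rw [Function.mem_support, stateWeight] at hst
  have h1 := left_ne_zero_of_mul hst
  have h2 : ∀ s c, st.m (Fin.succ s) c ≤ st.m (Fin.castSucc s) c + 1 := by
    intro s c
    have h3 := Finset.prod_ne_zero_iff.1 (Finset.prod_ne_zero_iff.1 h1 s (Finset.mem_univ _)) c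
      (Finset.mem_univ _)
    exact sixw_ne h3
  intro s c
  have h4 : ∀ s : Fin (2*r+1), st.m s c ≤ r + s.val := by
    intro s
    induction s using Fin.induction with
    | zero =>
      rw [st.bottom]
      refine (Finset.card_le_univ _).trans ?_
      simp
    | succ s ih =>
      have := h2 s c
      simp only [Fin.val_succ, Fin.val_castSucc] at *
      omega
  have := h4 s
  have := s.isLt
  omega

/-- The pair data: middle vertical edges, and labels of the two rows of a bend. -/
abbrev PairD (L : ℕ) : Type :=
  (Fin (L+1) → ℕ) × {g : Fin (L+2) → Bool × Bool // g (Fin.last (L+1)) = (false, false)}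

def sA {r : ℕ} (i : Fin r) : Fin (2*r) := ⟨2*i.val, by have := i.isLt; omega⟩
def sB {r : ℕ} (i : Fin r) : Fin (2*r) := ⟨2*i.val+1, by have := i.isLt; omega⟩

/-- Replace the two rows of bend `i`. -/
def upd {r : ℕ} {lam : Fin r → ℕ} {L : ℕ} (i : Fin r) (st : BCState r lam L) (p : PairD L) :
    BCState r lam L where
  m := fun s => if s = (sA i).succ then p.1 else st.m s
  h := fun s => if s = sA i then fun c => (p.2.1 c).2 else
    if s = sB i then fun c => (p.2.1 c).1 else st.h s
  bottom := by
    intro c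
    rw [if_neg (Fin.succ_ne_zero _).symm]
    exact st.bottom c
  top := by
    intro c
    rw [if_neg]
    · exact st.top c
    · have := i.isLt
      simp only [Fin.ext_iff, sA, Fin.val_last, Fin.val_succ]
      omega
  right := by
    intro s
    have := p.2.2
    split_ifs
    · simp [this]
    · simp [this]
    · exact st.right s

def getP {r : ℕ} {lam : Fin r → ℕ} {L : ℕ} (i : Fin r) (st : BCState r lam L) : PairD L :=
  (st.m (sA i).succ, ⟨fun c => (st.h (sB i) c, st.h (sA i) c), by simp [st.right]⟩)

def zeroP (L : ℕ) : PairD L := (fun _ => 0, ⟨fun _ => (false, false), rfl⟩)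

theorem sA_ne_sB {r : ℕ} (i : Fin r) : sB i ≠ sA i := by
  simp [sA, sB, Fin.ext_iff]

theorem getP_upd {r : ℕ} {lam : Fin r → ℕ} {L : ℕ} (i : Fin r) (st : BCState r lam L)
    (p : PairD L) : getP i (upd i st p) = p := by
  simp [getP, upd, sA_ne_sB]

theorem upd_upd {r : ℕ} {lam : Fin r → ℕ} {L : ℕ} (i : Fin r) (st : BCState r lam L)
    (p p' : PairD L) : upd i (upd i st p) p' = upd i st p' := by
  apply BCState.ext'
  · funext s; simp only [upd]; split_ifs <;> rfl
  · funext s; simp only [upd]; split_ifs <;> rfl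

theorem upd_getP {r : ℕ} {lam : Fin r → ℕ} {L : ℕ} (i : Fin r) (st : BCState r lam L) :
    upd i st (getP i st) = st := by
  apply BCState.ext'
  · funext s; simp only [upd, getP]; split_ifs with h
    · rw [h]
    · rfl
  · funext s; simp only [upd, getP]; split_ifs with h h'
    · rw [h]
    · rw [h']
    · rfl

def stEquiv {r : ℕ} {lam : Fin r → ℕ} {L : ℕ} (i : Fin r) :
    {st : BCState r lam L // getP i st = zeroP L} × PairD L ≃ BCState r lam L where
  toFun a := upd i a.1.1 a.2
  invFun st := (⟨upd i st (zeroP L), getP_upd _ _ _⟩, getP i st)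
  left_inv := by
    rintro ⟨⟨st, h⟩, p⟩
    ext1
    · apply Subtype.ext
      simp only [upd_upd]
      rw [← h, upd_getP]
    · simp only [getP_upd]
  right_inv := by
    intro st
    simp only [upd_upd, upd_getP]

/-- The weight contribution away from bend `i`. -/
def common {F : Type} [Field F] {r : ℕ} {lam : Fin r → ℕ} {L : ℕ} (i : Fin r)
    (q : F) (x : Fin r → F) (A B C D : Fin r → F) (st : BCState r lam L) : F :=
  (∏ s ∈ (Finset.univ.erase (sA i)).erase (sB i), ∏ c : Fin (L+1),
      sixw q (rowp x s) (st.h s c.castSucc) (st.h s c.succ)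
        (st.m s.succ c) (st.m s.castSucc c)) *
  ∏ j ∈ Finset.univ.erase i,
      bendw (A j) (B j) (C j) (D j) (st.h (sB j) 0) (st.h (sA j) 0)

theorem weight_split {F : Type} [Field F] {r : ℕ} {lam : Fin r → ℕ} {L : ℕ} (i : Fin r)
    (q : F) (x : Fin r → F) (A B C D : Fin r → F) (st : BCState r lam L) (p : PairD L) :
    stateWeight q x A B C D (upd i st p) = common i q x A B C D st *
      (bendw (A i) (B i) (C i) (D i) (p.2.1 0).1 (p.2.1 0).2 * ∏ j : Fin (L+1),
        (sixw q (x i) (p.2.1 j.castSucc).1 (p.2.1 j.succ).1 (st.m (sB i).succ j) (p.1 j) *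
          sixw q (x i)⁻¹ (p.2.1 j.castSucc).2 (p.2.1 j.succ).2 (p.1 j)
            (st.m (sA i).castSucc j))) := by
  have hBA : (sB i).castSucc = (sA i).succ := by simp [sA, sB, Fin.ext_iff]
  have hBs : (sB i).succ ≠ (sA i).succ := by simp [sA, sB, Fin.ext_iff]
  have hAs : (sA i).castSucc ≠ (sA i).succ := by simp [Fin.ext_iff]
  have hrA : rowp x (sA i) = (x i)⁻¹ := by
    have : (2 * i.val) / 2 = i.val := by omega
    simp [rowp, sA, this]
  have hrB : rowp x (sB i) = x i := by
    have : (2 * i.val + 1) / 2 = i.val := by omega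
    have h2 : (2 * i.val + 1) % 2 = 1 := by omega
    simp [rowp, sB, this, h2]
  have hs : stateWeight q x A B C D (upd i st p) =
    (∏ s : Fin (2*r), ∏ c : Fin (L+1),
      sixw q (rowp x s) ((upd i st p).h s c.castSucc) ((upd i st p).h s c.succ)
        ((upd i st p).m s.succ c) ((upd i st p).m s.castSucc c)) *
    ∏ j : Fin r, bendw (A j) (B j) (C j) (D j) ((upd i st p).h (sB j) 0)
      ((upd i st p).h (sA j) 0) := rfl
  rw [hs, ← Finset.mul_prod_erase Finset.univ _ (Finset.mem_univ i),
    ← Finset.mul_prod_erase Finset.univ _ (Finset.mem_univ (sA i)),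
    ← Finset.mul_prod_erase (Finset.univ.erase (sA i)) _
      (Finset.mem_erase.2 ⟨sA_ne_sB i, Finset.mem_univ (sB i)⟩)]
  have hc : common i q x A B C D (upd i st p) = common i q x A B C D st := by
    unfold common
    congr 1
    · refine Finset.prod_congr rfl fun s hs => Finset.prod_congr rfl fun c _ => ?_
      simp only [Finset.mem_erase, Finset.mem_univ, and_true] at hs
      have h1 : s.succ ≠ (sA i).succ := fun h => hs.2 (Fin.succ_injective _ h)
      have h2 : s.castSucc ≠ (sA i).succ := by
        rw [← hBA]; exact fun h => hs.1 (Fin.castSucc_injective _ h)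
      simp only [upd, if_neg h1, if_neg h2, if_neg hs.1, if_neg hs.2]
    · refine Finset.prod_congr rfl fun j hj => ?_
      have hj' : j.val ≠ i.val := fun h => (Finset.mem_erase.1 hj).1 (Fin.ext h)
      have h1 : sB j ≠ sA i := by simp only [sA, sB, ne_eq, Fin.ext_iff]; omega
      have h2 : sB j ≠ sB i := by simp only [sB, ne_eq, Fin.ext_iff]; omega
      have h3 : sA j ≠ sA i := by simp only [sA, ne_eq, Fin.ext_iff]; omega
      have h4 : sA j ≠ sB i := by simp only [sA, sB, ne_eq, Fin.ext_iff]; omega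
      simp only [upd, if_neg h1, if_neg h2, if_neg h3, if_neg h4]
  rw [← hc]
  unfold common
  rw [Finset.prod_mul_distrib, hrA, hrB]
  have e1 : (upd i st p).h (sA i) = fun c => (p.2.1 c).2 := by simp [upd]
  have e2 : (upd i st p).h (sB i) = fun c => (p.2.1 c).1 := by simp [upd, sA_ne_sB]
  have e3 : (upd i st p).m (sA i).succ = p.1 := by simp [upd]
  have e4 : (upd i st p).m (sB i).castSucc = p.1 := by rw [hBA, e3]
  have e5 : (upd i st p).m (sB i).succ = st.m (sB i).succ := by simp only [upd, if_neg hBs]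
  have e6 : (upd i st p).m (sA i).castSucc = st.m (sA i).castSucc := by
    simp only [upd, if_neg hAs]
  rw [e1, e2, e3, e4, e5, e6]
  ring

theorem ZBC_split {F : Type} [Field F] {r : ℕ} (lam : Fin r → ℕ) (L : ℕ) (i : Fin r)
    (e q : F) (x : Fin r → F) (A B C D : Fin r → F) :
    e * ZBC lam L q x A B C D =
      ∑ᶠ st : {st : BCState r lam L // getP i st = zeroP L},
        common i q x A B C D st.1 * pathS q (x i) (x i)⁻¹ (L+1)
          (fun t => e * bendw (A i) (B i) (C i) (D i) t.1 t.2)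
          (st.1.m (sB i).succ) (st.1.m (sA i).castSucc) := by
  unfold ZBC
  rw [← finsum_comp_equiv (stEquiv i), finsum_curry, ← smul_eq_mul, smul_finsum]
  · refine finsum_congr fun st => ?_
    rw [← pair_sum, smul_finsum, ← smul_eq_mul (common i q x A B C D st.1), smul_finsum]
    refine finsum_congr fun p => ?_
    show e • stateWeight q x A B C D (upd i st.1 p) = _
    rw [weight_split]
    simp only [smul_eq_mul]
    ring
  · exact (weight_finite lam L q x A B C D).preimage (stEquiv i).injective.injOn

theorem ZBC_symm {F : Type} [Field F] {r : ℕ} (lam : Fin r → ℕ) (L : ℕ) (i : Fin r)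
    (q : F) (x A B C D : Fin r → F) (x' A' B' C' D' : Fin r → F) (e e' a d p k : F)
    (hx : ∀ j, j ≠ i → x' j = x j) (hxi : x' i = (x i)⁻¹)
    (hA : ∀ j, j ≠ i → A' j = A j) (hB : ∀ j, j ≠ i → B' j = B j)
    (hC : ∀ j, j ≠ i → C' j = C j) (hD : ∀ j, j ≠ i → D' j = D j)
    (h1 : e * A i = a) (h1' : e' * A' i = a) (h2 : e * D i = d) (h2' : e' * D' i = d)
    (h3 : e * B i = p + k * (q * x i)) (h3' : e' * B' i = p + k * (q * (x i)⁻¹))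
    (h4 : e * C i = p + k * (x i)⁻¹) (h4' : e' * C' i = p + k * x i) :
    e' * ZBC lam L q x' A' B' C' D' = e * ZBC lam L q x A B C D := by
  rw [ZBC_split lam L i, ZBC_split lam L i]
  refine finsum_congr fun st => ?_
  have f1 : (fun t : Bool × Bool => e * bendw (A i) (B i) (C i) (D i) t.1 t.2) =
      bet q (x i) (x i)⁻¹ a d p k := by
    funext ⟨t, b⟩
    cases t <;> cases b <;> simp only [bet, bendw] <;> assumption
  have f2 : (fun t : Bool × Bool => e' * bendw (A' i) (B' i) (C' i) (D' i) t.1 t.2) =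
      bet q (x i)⁻¹ (x i) a d p k := by
    funext ⟨t, b⟩
    cases t <;> cases b <;> simp only [bet, bendw] <;> assumption
  rw [f1, f2, hxi, inv_inv, pathS_symm]
  congr 1
  unfold common
  congr 1
  · refine Finset.prod_congr rfl fun s hs => Finset.prod_congr rfl fun c _ => ?_
    simp only [Finset.mem_erase, Finset.mem_univ, and_true, sA, sB, ne_eq, Fin.ext_iff] at hs
    have : rowp x' s = rowp x s := by
      unfold rowp
      rw [hx]
      simp only [ne_eq, Fin.ext_iff]
      omega
    rw [this]
  · refine Finset.prod_congr rfl fun j hj => ?_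
    have hj' := (Finset.mem_erase.1 hj).1
    rw [hA j hj', hB j hj', hC j hj', hD j hj']

theorem map_sixw {F : Type} [Field F] (σ : F ≃+* F) (q z : F) (l r : Bool) (a b : ℕ) :
    σ (sixw q z l r a b) = sixw (σ q) (σ z) l r a b := by
  cases l <;> cases r <;> simp only [sixw] <;> split_ifs <;> simp

theorem map_ZBC {F : Type} [Field F] (σ : F ≃+* F) {r : ℕ} (lam : Fin r → ℕ) (L : ℕ)
    (q : F) (x A B C D : Fin r → F) :
    σ (ZBC lam L q x A B C D) = ZBC lam L (σ q) (fun j => σ (x j)) (fun j => σ (A j))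
      (fun j => σ (B j)) (fun j => σ (C j)) (fun j => σ (D j)) := by
  unfold ZBC
  have := AddEquiv.map_finsum σ.toAddEquiv
    (fun st : BCState r lam L => stateWeight q x A B C D st)
  refine this.trans (finsum_congr fun st => ?_)
  show σ _ = _
  unfold stateWeight
  rw [map_mul, map_prod, map_prod]
  congr 1
  · refine Finset.prod_congr rfl fun s _ => ?_
    rw [map_prod]
    refine Finset.prod_congr rfl fun c _ => ?_
    rw [map_sixw]
    congr 1
    unfold rowp
    split_ifs <;> simp
  · refine Finset.prod_congr rfl fun j _ => ?_
    generalize st.h _ 0 = u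
    generalize st.h _ 0 = v
    cases u <;> cases v <;> rfl

theorem fix_poly {r : ℕ} (σ : FF r ≃+* FF r) (hσc : ∀ z : ℂ, σ (cC r z) = cC r z)
    (hσq : σ (qv r) = qv r) {a : FF r} (h : IsPolyQ r a) : σ a = a := by
  obtain ⟨p, rfl⟩ := h
  rw [Polynomial.eval₂_eq_sum, Polynomial.sum, map_sum]
  refine Finset.sum_congr rfl fun n _ => ?_
  rw [map_mul, map_pow, hσc, hσq]

theorem fix_NoXi {r : ℕ} (i : Fin r) (σ : FF r ≃+* FF r) (hσc : ∀ z : ℂ, σ (cC r z) = cC r z)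
    (hσq : σ (qv r) = qv r) (hσx : ∀ j : Fin r, j ≠ i → σ (xv r j) = xv r j)
    {a : FF r} (h : a ∈ NoXi r i) : σ a = a := by
  unfold NoXi at h
  induction h using Subfield.closure_induction with
  | mem x hx =>
    rcases hx with (⟨z, rfl⟩ | hx) | ⟨j, hj, rfl⟩
    · exact hσc z
    · rw [Set.mem_singleton_iff.1 hx]; exact hσq
    · exact hσx j hj
  | one => exact map_one σ
  | add x y _ _ hx hy => rw [map_add, hx, hy]
  | neg x _ hx => rw [map_neg, hx]
  | inv x _ hx => rw [map_inv₀, hx]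
  | mul x y _ _ hx hy => rw [map_mul, hx, hy]

/-- Inversion symmetry of the partition function (Lemma 3.6): `σ` is the automorphism of
`ℂ(q, x₁, …, x_r)` fixing the constants, `q` and `x_j` for `j ≠ i` and sending
`xᵢ ↦ xᵢ⁻¹`. -/
theorem stmt8 (r : ℕ) (hr : 0 < r) (lam : Fin r → ℕ)
    (hlam : ∀ j k : Fin r, j ≤ k → lam k ≤ lam j)
    (A B C D : Fin r → FF r) (i : Fin r)
    (hAj : ∀ j, j ≠ i → A j ∈ NoXi r i) (hBj : ∀ j, j ≠ i → B j ∈ NoXi r i)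
    (hCj : ∀ j, j ≠ i → C j ∈ NoXi r i) (hDj : ∀ j, j ≠ i → D j ∈ NoXi r i)
    (σ : FF r ≃+* FF r)
    (hσc : ∀ z : ℂ, σ (cC r z) = cC r z)
    (hσq : σ (qv r) = qv r)
    (hσx : ∀ j : Fin r, j ≠ i → σ (xv r j) = xv r j)
    (hσi : σ (xv r i) = (xv r i)⁻¹) :
    (((B i = C i ∧ IsPolyQ r (A i) ∧ IsPolyQ r (B i) ∧ IsPolyQ r (C i) ∧ IsPolyQ r (D i)) ∨
        (∃ mi : FF r, IsPolyQ r mi ∧ C i = mi * (xv r i)⁻¹ ∧ B i = qv r * mi * xv r i ∧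
          IsPolyQ r (A i) ∧ IsPolyQ r (D i))) →
      σ (ZBC lam (lam ⟨0, hr⟩) (qv r) (xv r) A B C D)
        = ZBC lam (lam ⟨0, hr⟩) (qv r) (xv r) A B C D) ∧
    (((B i = -(qv r) * C i ∧ IsPolyQ r (C i) ∧ A i = 0 ∧ D i = 0) ∨
        (∃ mi : FF r, IsPolyQ r mi ∧ C i = mi * (xv r i)⁻¹ ∧ B i = -mi * xv r i ∧
          A i = 0 ∧ D i = 0)) →
      σ (((xv r i)⁻¹ - qv r * xv r i) * ZBC lam (lam ⟨0, hr⟩) (qv r) (xv r) A B C D)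
        = ((xv r i)⁻¹ - qv r * xv r i) * ZBC lam (lam ⟨0, hr⟩) (qv r) (xv r) A B C D) := by
  have hx0 : xv r i ≠ 0 := by
    unfold xv
    rw [Ne, FaithfulSMul.algebraMap_eq_zero_iff]
    exact MvPolynomial.X_ne_zero _
  have main : ∀ e a d p k : FF r,
      e * A i = a → σ e * σ (A i) = a → e * D i = d → σ e * σ (D i) = d →
      e * B i = p + k * (qv r * xv r i) → σ e * σ (B i) = p + k * (qv r * (xv r i)⁻¹) →
      e * C i = p + k * (xv r i)⁻¹ → σ e * σ (C i) = p + k * xv r i →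
      σ e * σ (ZBC lam (lam ⟨0, hr⟩) (qv r) (xv r) A B C D)
        = e * ZBC lam (lam ⟨0, hr⟩) (qv r) (xv r) A B C D := by
    intro e a d p k h1 h1' h2 h2' h3 h3' h4 h4'
    rw [map_ZBC, hσq]
    exact ZBC_symm lam _ i (qv r) (xv r) A B C D _ _ _ _ _ e (σ e) a d p k hσx hσi
      (fun j hj => fix_NoXi i σ hσc hσq hσx (hAj j hj))
      (fun j hj => fix_NoXi i σ hσc hσq hσx (hBj j hj))
      (fun j hj => fix_NoXi i σ hσc hσq hσx (hCj j hj))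
      (fun j hj => fix_NoXi i σ hσc hσq hσx (hDj j hj)) h1 h1' h2 h2' h3 h3' h4 h4'
  have hp : ∀ {a : FF r}, IsPolyQ r a → σ a = a := fun h => fix_poly σ hσc hσq h
  constructor
  · intro h
    have key : σ 1 * σ (ZBC lam (lam ⟨0, hr⟩) (qv r) (xv r) A B C D)
        = 1 * ZBC lam (lam ⟨0, hr⟩) (qv r) (xv r) A B C D := by
      rcases h with ⟨hBC, hA, hB, hC, hD⟩ | ⟨mi, hm, hC, hB, hA, hD⟩
      · refine main 1 (A i) (D i) (C i) 0 ?_ ?_ ?_ ?_ ?_ ?_ ?_ ?_ <;>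
          simp [hp hA, hp hC, hp hD, hBC]
      · refine main 1 (A i) (D i) 0 mi ?_ ?_ ?_ ?_ ?_ ?_ ?_ ?_ <;>
          (try simp only [hp hA, hp hD, hB, hC, map_one, map_mul, map_inv₀, hσi, hσq, hp hm, inv_inv])
            <;> ring
    simpa using key
  · intro h
    rw [map_mul]
    rcases h with ⟨hB, hC, hA, hD⟩ | ⟨mi, hm, hC, hB, hA, hD⟩
    · refine main _ 0 0 (-qv r * (xv r i + (xv r i)⁻¹) * C i) ((1 + qv r) * C i)
        ?_ ?_ ?_ ?_ ?_ ?_ ?_ ?_ <;>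
        (try simp only [hA, hD, hB, hp hC, map_sub, map_neg, map_zero, map_mul, map_inv₀, hσi, hσq,
          inv_inv]) <;> ring
    · refine main _ 0 0 (-(1 + qv r) * mi) ((xv r i + (xv r i)⁻¹) * mi)
        ?_ ?_ ?_ ?_ ?_ ?_ ?_ ?_ <;>
        (try simp only [hA, hD, hB, hC, hp hm, map_sub, map_neg, map_zero, map_mul, map_inv₀, hσi, hσq,
          inv_inv]) <;> (try field_simp) <;> ring
end
end

section
/- Rank-one evaluation, symmetric cases (Theorem 5.1, cases (1a) and (2b)): Consider the type B/C lattice model of rank 1 with partition λ = (λ₁), λ₁ ≥ 0, and bend weights A₁, B₁, C₁, D₁ that are Laurent monomials in x₁ with coefficients in ℂ[q] (or zero). (1a) If B₁ = C₁, then Z_λ = C₁ · [ x₁^{λ₁+1}·(1 − q·x₁⁻²)/(1 − x₁⁻²) + x₁^{−λ₁−1}·(1 − q·x₁²)/(1 − x₁²) ]; that is, Z_λ = C₁·Σ_{w∈W₀} w( x₁^{λ₁+1}·(1 − q·x₁⁻²)/(1 − x₁⁻²) ), where W₀ = {identity, x₁ ↦ x₁⁻¹}. (2b) If B₁ = q·x₁²·C₁,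 then Z_λ = x₁·C₁ · [ x₁^{λ₁}·(1 − q·x₁⁻²)/(1 − x₁⁻²) + x₁^{−λ₁}·(1 − q·x₁²)/(1 − x₁²) ]. -/
noncomputable section

/-- `ℂ(q, x₁)`. -/
abbrev F1 : Type := FractionRing (MvPolynomial (Fin 2) ℂ)

/-- The element `q` of `ℂ(q, x₁)`. -/
def q1 : F1 := algebraMap (MvPolynomial (Fin 2) ℂ) F1 (MvPolynomial.X 0)

/-- The element `x₁` of `ℂ(q, x₁)`. -/
def x1 : F1 := algebraMap (MvPolynomial (Fin 2) ℂ) F1 (MvPolynomial.X 1)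

/-- The embedding of the constants `ℂ` into `ℂ(q, x₁)`. -/
def cC1 : ℂ →+* F1 :=
  (algebraMap (MvPolynomial (Fin 2) ℂ) F1).comp MvPolynomial.C

/-- `a` is a Laurent monomial in `x₁` with coefficient in `ℂ[q]`,
i.e. `a = c·x₁ⁿ` with `c ∈ ℂ[q]` nonzero and `n ∈ ℤ`. -/
def LMono (a : F1) : Prop :=
  ∃ (p : Polynomial ℂ) (n : ℤ),
    p ≠ 0 ∧ a = Polynomial.eval₂ cC1 q1 p * x1 ^ n

/-- The partition function of the rank-one type B/C model with `λ = (l)` and bend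
weights `A, B, C, D`. -/
def Z1 (l : ℕ) (A B C D : F1) : F1 :=
  ZBC (fun _ : Fin 1 => l) l q1 (fun _ => x1)
    (fun _ => A) (fun _ => B) (fun _ => C) (fun _ => D)

/-- The state whose path leaves the bottom row upwards in column `j - 1` (or on the left if `j = 0`). -/
def stJ (l : ℕ) (j : Fin (l+2)) : BCState 1 (fun _ => l) l where
  m s c := if s.val = 0 then (if c.val = l then 1 else 0)
    else if s.val = 1 then (if c.val + 1 = j.val then 1 else 0) else 0
  h s c := if s.val = 0 then decide (j.val ≤ c.val ∧ c.val ≤ l) else decide (c.val < j.val)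
  bottom c := by
    by_cases h : c.val = l
    · simp [h]
    · have h' : ¬ l = c.val := fun e => h e.symm
      simp [h, h']
  top c := by simp
  right s := by
    have := j.isLt
    split_ifs <;> simp <;> omega

theorem stJ_h0 (l : ℕ) (j c : Fin (l+2)) :
    (stJ l j).h 0 c = decide (j.val ≤ c.val ∧ c.val ≤ l) := rfl

theorem stJ_h1 (l : ℕ) (j c : Fin (l+2)) :
    (stJ l j).h 1 c = decide (c.val < j.val) := rfl

theorem stJ_inj (l : ℕ) : Function.Injective (stJ l) := by
  intro i j hij
  have h : ∀ c : Fin (l+2), (c.val < i.val ↔ c.val < j.val) := by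
    intro c
    have := congrArg (fun s => s.h 1 c) hij
    simpa [stJ] using this
  have h1 := h i
  have h2 := h j
  ext
  omega

theorem sixw_cons {F : Type} [Field F] {q z : F} {hl hr : Bool} {a b : ℕ}
    (h : sixw q z hl hr a b ≠ 0) : hr.toNat + b = hl.toNat + a := by
  cases hl <;> cases hr <;> simp [sixw] at h ⊢ <;> omega

theorem prod_two' {F : Type} [Field F] (f : Fin (2*1) → F) : ∏ s, f s = f 0 * f 1 :=
  Fin.prod_univ_two f

theorem exists_stJ {l : ℕ} {q x A B C D : F1} (st : BCState 1 (fun _ => l) l)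
    (h : stateWeight q (fun _ => x) (fun _ => A) (fun _ => B) (fun _ => C) (fun _ => D) st ≠ 0) :
    ∃ j, stJ l j = st := by
  unfold stateWeight at h
  have h1 := left_ne_zero_of_mul h
  rw [prod_two'] at h1
  have r0 := Finset.prod_ne_zero_iff.1 (left_ne_zero_of_mul h1)
  have r1 := Finset.prod_ne_zero_iff.1 (right_ne_zero_of_mul h1)
  obtain ⟨m, hh, bot, top, right⟩ := st
  have c0 : ∀ c : Fin (l+1), (hh 0 c.succ).toNat + m 0 c = (hh 0 c.castSucc).toNat + m 1 c :=
    fun c => sixw_cons (r0 c (Finset.mem_univ _))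
  have c1 : ∀ c : Fin (l+1), (hh 1 c.succ).toNat + m 1 c = (hh 1 c.castSucc).toNat + m 2 c :=
    fun c => sixw_cons (r1 c (Finset.mem_univ _))
  have t : ∀ c : Fin (l+1), m 2 c = 0 := top
  have b : ∀ c : Fin (l+1), m 0 c = if c.val = l then 1 else 0 := by
    intro c
    rw [bot]
    by_cases h : c.val = l
    · simp [h]
    · have h' : ¬ l = c.val := fun e => h e.symm
      simp [h, h']
  have e0 := right 0
  have e1 := right 1
  have inv : ∀ c : Fin (l+2), (hh 0 c).toNat + (hh 1 c).toNat = if c.val ≤ l then 1 else 0 := by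
    intro c
    induction c using Fin.reverseInduction with
    | last => simp [e0, e1]
    | cast i ih =>
      have a0 := c0 i
      have a1 := c1 i
      have := i.isLt
      rw [t] at a1
      rw [b] at a0
      simp only [Fin.val_succ, Fin.val_castSucc] at ih ⊢
      split_ifs at * <;> omega
  obtain ⟨j, hj⟩ : ∃ j : Fin (l+2), ∀ c : Fin (l+2), hh 1 c = decide (c.val < j.val) := by
    have ex : ∃ n, ∃ hn : n < l+2, hh 1 ⟨n, hn⟩ = false := ⟨l+1, by omega, e1⟩
    classical
    obtain ⟨hn, hf⟩ := Nat.find_spec ex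
    refine ⟨⟨Nat.find ex, hn⟩, ?_⟩
    intro c
    by_cases hc : c.val < Nat.find ex
    · have := Nat.find_min ex hc
      simp only [not_exists] at this
      have := this c.isLt
      simpa [hc] using this
    · simp only [hc, decide_false]
      have key : ∀ k (hk : Nat.find ex + k < l + 2), hh 1 ⟨Nat.find ex + k, hk⟩ = false := by
        intro k
        induction k with
        | zero => intro _; exact hf
        | succ k ih =>
          intro hk
          have i1 := ih (by omega)
          have a1 := c1 ⟨Nat.find ex + k, by omega⟩
          rw [t] at a1
          simp only [Fin.succ_mk, Fin.castSucc_mk, i1] at a1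
          cases hx : hh 1 ⟨Nat.find ex + (k+1), hk⟩
          · rfl
          · have : hh 1 ⟨Nat.find ex + k + 1, hk⟩ = true := hx
            simp [this] at a1
      have := key (c.val - Nat.find ex) (by omega)
      have e : (⟨Nat.find ex + (c.val - Nat.find ex), by omega⟩ : Fin (l+2)) = c := by
        ext; simp; omega
      rwa [e] at this
  refine ⟨j, ?_⟩
  have hm : (stJ l j).m = m := by
    funext s c
    have a1 := c1 c
    rw [t, hj, hj] at a1
    have s3 : s = 0 ∨ s = 1 ∨ s = 2 := by
      have : ∀ s : Fin 3, s = 0 ∨ s = 1 ∨ s = 2 := by decide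
      exact this s
    rcases s3 with rfl | rfl | rfl
    · rw [b]; simp [stJ]
    · have : (stJ l j).m 1 c = if c.val + 1 = j.val then 1 else 0 := by simp [stJ]
      rw [this]
      simp only [Fin.val_succ, Fin.val_castSucc] at a1
      by_cases p : c.val + 1 < j.val <;> by_cases p' : c.val < j.val <;>
        simp [p, p'] at a1 <;> split_ifs <;> omega
    · rw [t]; rfl
  have hhh : (stJ l j).h = hh := by
    funext s c
    have i1 := inv c
    rw [hj] at i1
    have s3 : s = 0 ∨ s = 1 := by
      have : ∀ s : Fin 2, s = 0 ∨ s = 1 := by decide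
      exact this s
    rcases s3 with rfl | rfl
    · have : (stJ l j).h 0 c = decide (j.val ≤ c.val ∧ c.val ≤ l) := by simp [stJ]
      rw [this]
      have := j.isLt
      by_cases p : c.val < j.val <;> by_cases p' : c.val ≤ l <;> cases hx : hh 0 c <;>
        simp [p, p', hx] at i1 ⊢ <;> omega
    · rw [hj]; rfl
  cases hm
  cases hhh
  rfl

theorem prod_thr {F : Type} [Field F] (y : F) (j n : ℕ) :
    ∏ c ∈ Finset.range n, (if j ≤ c then y else 1) = y ^ (n - j) := by
  induction n with
  | zero => simp
  | succ n ih =>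
    rw [Finset.prod_range_succ, ih]
    split_ifs with h
    · rw [← pow_succ]; congr 1; omega
    · rw [mul_one]; congr 1
      rw [show n - j = 0 by omega, show n + 1 - j = 0 by omega]

theorem prod_thr' {F : Type} [Field F] (y : F) (j n : ℕ) (hj : j ≤ n) :
    ∏ c ∈ Finset.range n, (if c < j then y else 1) = y ^ j := by
  rw [← Finset.prod_filter]
  rw [Finset.prod_const]
  congr 1
  rw [show (Finset.range n).filter (fun c => c < j) = Finset.range j by ext; simp; omega]
  simp

theorem weight_stJ (l : ℕ) (q x A B C D : F1) (j : Fin (l+2)) :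
    stateWeight q (fun _ => x) (fun _ => A) (fun _ => B) (fun _ => C) (fun _ => D) (stJ l j)
      = ((if j.val = 0 ∨ j.val = l + 1 then 1 else 1 - q) * x⁻¹ ^ (l + 1 - j.val)) * x ^ j.val
        * (if j.val = 0 then B else C) := by
  have jl := j.isLt
  unfold stateWeight
  rw [prod_two']
  congr 1
  · congr 1
    · have e : ∀ c : Fin (l+1), sixw q (rowp (fun _ : Fin 1 => x) 0) ((stJ l j).h 0 c.castSucc)
          ((stJ l j).h 0 c.succ) ((stJ l j).m (Fin.succ 0) c) ((stJ l j).m (Fin.castSucc 0) c)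
          = (fun c : ℕ => (if c + 1 = j.val ∧ c < l then 1 - q else 1) *
              (if j.val ≤ c then x⁻¹ else 1)) c.val := by
        intro c
        have cl := c.isLt
        have h0 : (stJ l j).h 0 c.castSucc = decide (j.val ≤ c.val) := by
          rw [stJ_h0, decide_eq_decide, Fin.val_castSucc]; omega
        have h1 : (stJ l j).h 0 c.succ = decide (j.val ≤ c.val + 1 ∧ c.val < l) := by
          rw [stJ_h0, decide_eq_decide, Fin.val_succ]; omega
        have m0 : (stJ l j).m (Fin.succ 0) c = if c.val + 1 = j.val then 1 else 0 := by
          simp [stJ]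
        have m1 : (stJ l j).m (Fin.castSucc 0) c = if c.val = l then 1 else 0 := by
          simp [stJ]
        have hr : rowp (fun _ : Fin 1 => x) 0 = x⁻¹ := by simp [rowp]
        rw [h0, h1, m0, m1, hr]
        rcases lt_trichotomy (c.val + 1) j.val with p | p | p
        · have p1 : ¬ j.val ≤ c.val := by omega
          have p2 : ¬ j.val ≤ c.val + 1 := by omega
          have p3 : ¬ c.val + 1 = j.val := by omega
          have p4 : ¬ c.val = l := by omega
          simp [p1, p2, p3, p4, sixw]
        · have p1 : ¬ j.val ≤ c.val := by omega
          by_cases p4 : c.val = l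
          · have p5 : ¬ c.val < l := by omega
            rw [if_pos p, if_pos p4]
            simp [sixw, p1, p5]
          · have p5 : c.val < l := by omega
            simp only [p1, p, p4, p5]
            simp [sixw]
        · have p1 : j.val ≤ c.val := by omega
          have p2 : j.val ≤ c.val + 1 := by omega
          have p3 : ¬ c.val + 1 = j.val := by omega
          by_cases p4 : c.val = l
          · have p5 : ¬ c.val < l := by omega
            rw [if_neg p3, if_pos p4]
            simp [sixw, p1, p5]
          · have p5 : c.val < l := by omega
            simp only [p1, p2, p3, p4, p5]
            simp [sixw]
      rw [Finset.prod_congr rfl (fun c _ => e c)]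
      rw [Fin.prod_univ_eq_prod_range (fun c : ℕ => (if c + 1 = j.val ∧ c < l then 1 - q else 1) *
              (if j.val ≤ c then x⁻¹ else 1)) (l+1), Finset.prod_mul_distrib, prod_thr]
      congr 1
      split_ifs with h
      · apply Finset.prod_eq_one
        intro c _
        rw [if_neg]; omega
      · rw [Finset.prod_eq_single (j.val - 1)]
        · rw [if_pos]; omega
        · intro c _ hc
          rw [if_neg]; omega
        · intro hc
          simp at hc; omega
    · have e : ∀ c : Fin (l+1), sixw q (rowp (fun _ : Fin 1 => x) 1) ((stJ l j).h 1 c.castSucc)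
          ((stJ l j).h 1 c.succ) ((stJ l j).m (Fin.succ 1) c) ((stJ l j).m (Fin.castSucc 1) c)
          = (fun c : ℕ => (if c < j.val then x else 1)) c.val := by
        intro c
        have h0 : (stJ l j).h 1 c.castSucc = decide (c.val < j.val) := stJ_h1 _ _ _
        have h1 : (stJ l j).h 1 c.succ = decide (c.val + 1 < j.val) := by
          rw [stJ_h1, Fin.val_succ]
        have m0 : (stJ l j).m (Fin.succ 1) c = 0 := by
          simp [stJ]
        have m1 : (stJ l j).m (Fin.castSucc 1) c = if c.val + 1 = j.val then 1 else 0 := by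
          simp [stJ]
        have hr : rowp (fun _ : Fin 1 => x) 1 = x := by simp [rowp]
        rw [h0, h1, m0, m1, hr]
        rcases lt_trichotomy (c.val + 1) j.val with p | p | p
        · have p1 : c.val < j.val := by omega
          have p3 : ¬ c.val + 1 = j.val := by omega
          simp [p, p1, p3, sixw]
        · have p1 : c.val < j.val := by omega
          have p2 : ¬ c.val + 1 < j.val := by omega
          simp only [p1, p2, if_pos p]
          simp [sixw]
        · have p1 : ¬ c.val < j.val := by omega
          have p2 : ¬ c.val + 1 < j.val := by omega
          have p3 : ¬ c.val + 1 = j.val := by omega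
          simp [p1, p2, p3, sixw]
      rw [Finset.prod_congr rfl (fun c _ => e c)]
      rw [Fin.prod_univ_eq_prod_range (fun c : ℕ => (if c < j.val then x else 1)) (l+1),
        prod_thr' _ _ _ (by omega)]
  · rw [Fin.prod_univ_one]
    have b0 : (stJ l j).h ⟨2 * (0 : Fin 1).val + 1, by simp⟩ 0 = decide (0 < j.val) := rfl
    have b1 : (stJ l j).h ⟨2 * (0 : Fin 1).val, by simp⟩ 0 = decide (j.val ≤ 0 ∧ 0 ≤ l) := rfl
    rw [b0, b1]
    by_cases h : j.val = 0
    · rw [h]; simp [bendw]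
    · have h0 : 0 < j.val := by omega
      have h1 : ¬ (j.val ≤ 0 ∧ 0 ≤ l) := by omega
      rw [if_neg h, decide_eq_true h0, decide_eq_false h1]; rfl

theorem geo {F : Type} [Field F] (x : F) (hx : x ≠ 0) (l : ℕ) :
    (x ^ 2 - 1) * ∑ c ∈ Finset.range l, x⁻¹ ^ (l - c) * x ^ (c + 1)
      = x * (x ^ l - x⁻¹ ^ l) := by
  induction l with
  | zero => simp
  | succ l ih =>
    rw [Finset.sum_range_succ]
    have : ∑ c ∈ Finset.range l, x⁻¹ ^ (l + 1 - c) * x ^ (c + 1)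
        = x⁻¹ * ∑ c ∈ Finset.range l, x⁻¹ ^ (l - c) * x ^ (c + 1) := by
      rw [Finset.mul_sum]
      apply Finset.sum_congr rfl
      intro c hc
      have := Finset.mem_range.1 hc
      rw [show l + 1 - c = (l - c) + 1 by omega]
      ring
    rw [this, mul_add, mul_left_comm, ih, show l + 1 - l = 1 by omega]
    have hy : x * x⁻¹ = 1 := mul_inv_cancel₀ hx
    generalize x⁻¹ = y at *
    linear_combination (x ^ l * x ^2 - x^l + x^l - y^l + y^l - x^l * x^2 + x^(l+2)) * hy

theorem Z1_eq (l : ℕ) (A B C D : F1) :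
    Z1 l A B C D = B * x1⁻¹ ^ (l + 1) + C * (x1 ^ (l + 1) +
      (1 - q1) * ∑ c ∈ Finset.range l, x1⁻¹ ^ (l - c) * x1 ^ (c + 1)) := by
  unfold Z1 ZBC
  rw [finsum_eq_sum_of_support_subset (s := Finset.univ.map ⟨stJ l, stJ_inj l⟩)]
  · rw [Finset.sum_map]
    simp only [Function.Embedding.coeFn_mk, weight_stJ]
    rw [Fin.sum_univ_eq_sum_range (fun j : ℕ =>
      ((if j = 0 ∨ j = l + 1 then 1 else 1 - q1) * x1⁻¹ ^ (l + 1 - j)) * x1 ^ j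
        * (if j = 0 then B else C)) (l+2), Finset.sum_range_succ', Finset.sum_range_succ]
    have : ∀ c ∈ Finset.range l, ((if c + 1 = 0 ∨ c + 1 = l + 1 then 1 else 1 - q1)
        * x1⁻¹ ^ (l + 1 - (c + 1))) * x1 ^ (c + 1) * (if c + 1 = 0 then B else C)
        = C * ((1 - q1) * (x1⁻¹ ^ (l - c) * x1 ^ (c + 1))) := by
      intro c hc
      have := Finset.mem_range.1 hc
      rw [if_neg (by omega), if_neg (by omega), show l + 1 - (c + 1) = l - c by omega]
      ring
    rw [Finset.sum_congr rfl this, ← Finset.mul_sum, ← Finset.mul_sum]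
    simp
    ring
  · intro st hst
    obtain ⟨j, hj⟩ := exists_stJ st hst
    simp only [Finset.coe_map, Function.Embedding.coeFn_mk, Finset.coe_univ, Set.image_univ]
    exact ⟨j, hj⟩

theorem x1_ne : x1 ≠ 0 := by
  unfold x1
  intro h
  rw [map_eq_zero_iff _ (IsFractionRing.injective _ _)] at h
  exact MvPolynomial.X_ne_zero _ h

theorem x1_sq : x1 ^ 2 - 1 ≠ 0 := by
  unfold x1
  intro h
  rw [← map_pow, ← map_one (algebraMap (MvPolynomial (Fin 2) ℂ) F1), ← map_sub,
    map_eq_zero_iff _ (IsFractionRing.injective _ _)] at h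
  have := congrArg (MvPolynomial.eval (fun _ => (0:ℂ))) h
  simp at this

/-- Rank-one evaluation, symmetric cases (Theorem 5.1, cases (1a) and (2b)). -/
theorem stmt10 (l : ℕ) (A B C D : F1)
    (hA : A = 0 ∨ LMono A) (hB : B = 0 ∨ LMono B)
    (hC : C = 0 ∨ LMono C) (hD : D = 0 ∨ LMono D) :
    (B = C →
      Z1 l A B C D
        = C * (x1 ^ (l + 1) * (1 - q1 * (x1 ^ 2)⁻¹) / (1 - (x1 ^ 2)⁻¹)
            + x1⁻¹ ^ (l + 1) * (1 - q1 * x1 ^ 2) / (1 - x1 ^ 2))) ∧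
    (B = q1 * x1 ^ 2 * C →
      Z1 l A B C D
        = x1 * C * (x1 ^ l * (1 - q1 * (x1 ^ 2)⁻¹) / (1 - (x1 ^ 2)⁻¹)
            + x1⁻¹ ^ l * (1 - q1 * x1 ^ 2) / (1 - x1 ^ 2))) := by
  have hx := x1_ne
  have h2 := x1_sq
  have h3 : 1 - x1 ^ 2 ≠ 0 := fun h => h2 (by linear_combination -h)
  have g := geo x1 hx l
  rw [Z1_eq]
  have i1 : ∀ u : F1, u * (1 - q1 * (x1 ^ 2)⁻¹) / (1 - (x1 ^ 2)⁻¹)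
      = u * (x1 ^ 2 - q1) / (x1 ^ 2 - 1) := by
    intro u
    have : 1 - (x1 ^ 2)⁻¹ ≠ 0 := by
      intro h
      apply h2
      field_simp at h
      simpa using h
    field_simp
  have i2 : ∀ u : F1, u / (1 - x1 ^ 2) = - u / (x1 ^ 2 - 1) := by
    intro u
    rw [div_eq_div_iff h3 h2]; ring
  have hS := eq_div_of_mul_eq h2 ((mul_comm _ _).trans g)
  rw [hS, i1, i2, i1, i2]
  have hy : x1 * x1⁻¹ = 1 := mul_inv_cancel₀ hx
  generalize x1⁻¹ = y at *
  constructor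
  · rintro rfl
    field_simp
    linear_combination (B * y ^ l * x1 * (1 - q1)) * hy
  · rintro rfl
    field_simp
    linear_combination (C * q1 * y ^ l * (x1 ^ 3 - x1)) * hy
end
end
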